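/- Let L be a domain and let E be a metrizable topological space. Every L-valued optimal measure ν on the Borel σ-algebra ℬ of E satisfies, for every B ∈ ℬ: ν(B) is the infimum of {ν(G) : G open, G ⊇ B} and ν(B) is the supremum of {ν(F) : F closed, F ⊆ B}. -/

import Mathlib

open Set

universe u v

section OrderDefs
variable {L : Type u} [PartialOrder L]

/-- A filtered (nonempty, downward directed) subset of a poset. -/
def DirFiltered (F : Set L) : Prop :=
  F.Nonempty ∧ ∀ r ∈ F, ∀ s ∈ F, ∃ t ∈ F, t ≤ r ∧ t ≤ s

/-- A filter of a poset: a filtered upper set. -/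
def OrdFilter (F : Set L) : Prop :=
  DirFiltered F ∧ ∀ r ∈ F, ∀ s : L, r ≤ s → s ∈ F

/-- Every filter has an infimum. -/
def FilteredComplete (L : Type u) [PartialOrder L] : Prop :=
  ∀ F : Set L, OrdFilter F → ∃ i : L, IsGLB F i

/-- `s` is way-above `r`: for every filter `F` with an infimum below `r`, `s ∈ F`. -/
def WayAbove (s r : L) : Prop :=
  ∀ F : Set L, OrdFilter F → ∀ i : L, IsGLB F i → i ≤ r → s ∈ F

/-- The poset is continuous: for every `r`, the set of elements way-above `r`
is a filter whose infimum is `r`. -/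
def ContinuousPoset (L : Type u) [PartialOrder L] : Prop :=
  ∀ r : L, OrdFilter {s : L | WayAbove s r} ∧ IsGLB {s : L | WayAbove s r} r

/-- Conditional completeness: every nonempty set bounded above has a supremum. -/
def CondComplete (L : Type u) [PartialOrder L] : Prop :=
  ∀ S : Set L, S.Nonempty → BddAbove S → ∃ m : L, IsLUB S m

end OrderDefs

/-- A domain: a filtered-complete continuous poset with a least element. -/
def DomainPoset (L : Type u) [PartialOrder L] [OrderBot L] : Prop :=
  FilteredComplete L ∧ ContinuousPoset L

section TopDefs
variable {E : Type v} [TopologicalSpace E]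

/-- The saturation of a set: intersection of all open sets containing it. -/
def satur (A : Set E) : Set E := ⋂₀ {G : Set E | IsOpen G ∧ A ⊆ G}

/-- A set is saturated if it is an intersection of open sets. -/
def IsSatur (A : Set E) : Prop :=
  ∃ 𝒢 : Set (Set E), (∀ G ∈ 𝒢, IsOpen G) ∧ A = ⋂₀ 𝒢

/-- The collection 𝒬 of compact saturated subsets. -/
def CompactSat (E : Type v) [TopologicalSpace E] : Set (Set E) :=
  {A : Set E | IsCompact A ∧ IsSatur A}

/-- The Borel σ-algebra generated by open sets and compact saturated sets. -/
def BorelM (E : Type v) [TopologicalSpace E] : MeasurableSpace E :=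
  MeasurableSpace.generateFrom ({A : Set E | IsOpen A} ∪ CompactSat E)

/-- Borel subsets for the σ-algebra generated by opens and compact saturated sets. -/
def IsBorelSet (B : Set E) : Prop := @MeasurableSet E (BorelM E) B

/-- The collection 𝒦 of compact Borel subsets. -/
def CompactBorel (E : Type v) [TopologicalSpace E] : Set (Set E) :=
  {A : Set E | IsBorelSet A ∧ IsCompact A}

/-- `[x]` : the compact Borel set `↑{x} ∩ closure {x}`. -/
def ptClass (x : E) : Set E := satur {x} ∩ closure {x}

end TopDefs

section MeasDefs
variable {L : Type u} {E : Type v} [PartialOrder L] [OrderBot L] [TopologicalSpace E]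

/-- An L-valued maxitive measure on the Borel σ-algebra. -/
def Maxitive (ν : Set E → L) : Prop :=
  ν ∅ = ⊥ ∧ ∀ 𝒞 : Set (Set E), 𝒞.Finite → (∀ B ∈ 𝒞, IsBorelSet B) →
    IsLUB (ν '' 𝒞) (ν (⋃₀ 𝒞))

/-- σ-maxitivity. -/
def SigmaMaxitive (ν : Set E → L) : Prop :=
  Maxitive ν ∧ ∀ 𝒞 : Set (Set E), 𝒞.Countable → (∀ B ∈ 𝒞, IsBorelSet B) →
    IsLUB (ν '' 𝒞) (ν (⋃₀ 𝒞))

/-- Complete maxitivity. -/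
def CompletelyMaxitive (ν : Set E → L) : Prop :=
  Maxitive ν ∧ ∀ 𝒞 : Set (Set E), (∀ B ∈ 𝒞, IsBorelSet B) → IsBorelSet (⋃₀ 𝒞) →
    IsLUB (ν '' 𝒞) (ν (⋃₀ 𝒞))

/-- The set `{ν G : G open, G ⊇ B}`. -/
def outerVals (ν : Set E → L) (B : Set E) : Set L :=
  {l : L | ∃ G : Set E, IsOpen G ∧ B ⊆ G ∧ ν G = l}

/-- `νp` is the map `ν⁺ : B ↦ inf {ν G : G open, G ⊇ B}` on Borel sets. -/
def IsNuPlus (ν νp : Set E → L) : Prop :=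
  ∀ B : Set E, IsBorelSet B → IsGLB (outerVals ν B) (νp B)

/-- Outer-continuity. -/
def OuterContinuous (ν : Set E → L) : Prop :=
  ∀ B : Set E, IsBorelSet B → IsGLB (outerVals ν B) (ν B)

/-- Inner-continuity. -/
def InnerContinuous (ν : Set E → L) : Prop :=
  ∀ B : Set E, IsBorelSet B →
    IsLUB {l : L | ∃ K : Set E, IsBorelSet K ∧ IsCompact K ∧ K ⊆ B ∧ ν (satur K) = l} (ν B)

/-- Regularity: inner- and outer-continuity. -/
def RegularMeasure (ν : Set E → L) : Prop :=
  InnerContinuous ν ∧ OuterContinuous ν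

/-- Weak outer-continuity: `ν K = ν⁺ K` for every compact Borel `K`. -/
def WeaklyOuterContinuous (ν : Set E → L) : Prop :=
  ∀ K : Set E, IsBorelSet K → IsCompact K → IsGLB (outerVals ν K) (ν K)

/-- Weak inner-continuity (relative to a given `ν⁺ = νp`). -/
def WeaklyInnerContinuous (ν νp : Set E → L) : Prop :=
  ∀ G : Set E, IsOpen G →
    IsLUB {l : L | ∃ K : Set E, IsBorelSet K ∧ IsCompact K ∧ K ⊆ G ∧ νp K = l} (ν G)

/-- 𝒜-smoothness. -/
def SmoothWrt (ν : Set E → L) (𝒜 : Set (Set E)) : Prop :=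
  ∀ 𝒟 : Set (Set E), 𝒟.Nonempty → 𝒟 ⊆ 𝒜 → DirectedOn (· ⊇ ·) 𝒟 →
    IsGLB (ν '' 𝒟) (ν (⋂₀ 𝒟))

/-- Saturation of a maxitive measure: `ν K = ν (↑K)` for compact Borel `K`. -/
def SaturatedMeasure (ν : Set E → L) : Prop :=
  ∀ K : Set E, IsBorelSet K → IsCompact K → ν K = ν (satur K)

/-- Tightness: `inf {ν (E ∖ K) : K compact Borel} = 0`. -/
def TightMeasure (ν : Set E → L) : Prop :=
  IsGLB {l : L | ∃ K : Set E, IsBorelSet K ∧ IsCompact K ∧ ν Kᶜ = l} (⊥ : L)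

/-- `c` is a cardinal density of `ν`. -/
def IsCardinalDensity (ν : Set E → L) (c : E → L) : Prop :=
  ∀ B : Set E, IsBorelSet B → IsLUB (c '' B) (ν B)

/-- Upper semicontinuity of a map into the poset. -/
def UscMap (c : E → L) : Prop := ∀ t : L, IsOpen {x : E | WayAbove t (c x)}

/-- Upper compactness of a map into the poset. -/
def UpperCompactMap (c : E → L) : Prop :=
  ∀ t : L, WayAbove t (⊥ : L) → IsCompact {x : E | ¬ WayAbove t (c x)}

/-- Continuity from above along decreasing sequences of Borel sets. -/
def ContinuousFromAbove (ν : Set E → L) : Prop :=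
  ∀ B : ℕ → Set E, (∀ n, IsBorelSet (B n)) → (∀ n, B (n + 1) ⊆ B n) →
    IsGLB (Set.range fun n => ν (B n)) (ν (⋂ n, B n))

/-- An optimal measure: a σ-maxitive measure continuous from above. -/
def OptimalMeasure (ν : Set E → L) : Prop :=
  SigmaMaxitive ν ∧ ContinuousFromAbove ν

/-- `flo` is the regular part `⌊ν⌋` (relative to `νp = ν⁺`):
`⌊ν⌋(B) = sup {ν⁺(K) : K compact Borel, K ⊆ B}`. -/
def RegPartRel (νp flo : Set E → L) : Prop :=
  ∀ B : Set E, IsBorelSet B →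
    IsLUB {l : L | ∃ K : Set E, IsBorelSet K ∧ IsCompact K ∧ K ⊆ B ∧ νp K = l} (flo B)

end MeasDefs

section WayAbove
variable {L : Type u} [PartialOrder L]

theorem WayAbove.le {s r : L} (h : WayAbove s r) : r ≤ s :=
  h (Ici r) ⟨⟨⟨r, le_rfl⟩, fun _ ha _ hb => ⟨r, le_rfl, ha, hb⟩⟩, fun _ ha _ hab => le_trans ha hab⟩
    r isGLB_Ici le_rfl

theorem WayAbove.mono {s s' r r' : L} (h : WayAbove s r) (hs : s ≤ s') (hr : r' ≤ r) :
    WayAbove s' r' :=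
  fun F hF i hi hir => hF.2 s (h F hF i hi (hir.trans hr)) s' hs

theorem WayAbove.exists_le_of_antitone {t i : L} (h : WayAbove t i) {f : ℕ → L}
    (hf : Antitone f) (hi : IsGLB (range f) i) : ∃ n, f n ≤ t := by
  refine h {s | ∃ n, f n ≤ s} ⟨⟨⟨f 0, 0, le_rfl⟩, ?_⟩, ?_⟩ i ⟨?_, ?_⟩ le_rfl
  · rintro r ⟨m, hm⟩ s ⟨n, hn⟩
    exact ⟨f (max m n), ⟨_, le_rfl⟩, (hf (le_max_left m n)).trans hm,
      (hf (le_max_right m n)).trans hn⟩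
  · rintro r ⟨m, hm⟩ s hrs
    exact ⟨m, hm.trans hrs⟩
  · rintro s ⟨n, hn⟩
    exact (hi.1 (mem_range_self n)).trans hn
  · intro b hb
    refine hi.2 ?_
    rintro _ ⟨n, rfl⟩
    exact hb ⟨n, le_rfl⟩

/-- The way-above relation of a continuous poset is interpolating. -/
theorem ContinuousPoset.exists_between (hL : ContinuousPoset L) {t r : L} (h : WayAbove t r) :
    ∃ u, WayAbove t u ∧ WayAbove u r := by
  refine h {s | ∃ u, WayAbove s u ∧ WayAbove u r} ⟨⟨?_, ?_⟩, ?_⟩ r ⟨?_, ?_⟩ le_rfl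
  · obtain ⟨s, hs⟩ := (hL t).1.1.1
    exact ⟨s, t, hs, h⟩
  · rintro s₁ ⟨u₁, hs₁, hu₁⟩ s₂ ⟨u₂, hs₂, hu₂⟩
    obtain ⟨u, hu, h₁, h₂⟩ := (hL r).1.1.2 u₁ hu₁ u₂ hu₂
    obtain ⟨s, hs, h₃, h₄⟩ :=
      (hL u).1.1.2 s₁ (hs₁.mono le_rfl h₁) s₂ (hs₂.mono le_rfl h₂)
    exact ⟨s, ⟨u, hs, hu⟩, h₃, h₄⟩
  · rintro s ⟨u, hs, hu⟩ s' hss'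
    exact ⟨u, hs.mono hss' le_rfl, hu⟩
  · rintro s ⟨u, hs, hu⟩
    exact hu.le.trans hs.le
  · intro b hb
    exact (hL r).2.2 fun u hu => (hL u).2.2 fun s hs => hb ⟨u, hs, hu⟩

theorem ContinuousPoset.le_of_forall_wayAbove (hL : ContinuousPoset L) {a r : L}
    (h : ∀ t, WayAbove t r → a ≤ t) : a ≤ r :=
  (hL r).2.2 h

end WayAbove

section Borel
variable {E : Type v} [TopologicalSpace E]

theorem IsOpen.isBorelSet {G : Set E} (hG : IsOpen G) : IsBorelSet G :=
  MeasurableSpace.measurableSet_generateFrom (Or.inl hG)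

theorem IsBorelSet.compl {B : Set E} (hB : IsBorelSet B) : IsBorelSet Bᶜ :=
  @MeasurableSet.compl E B (BorelM E) hB

theorem IsClosed.isBorelSet {F : Set E} (hF : IsClosed F) : IsBorelSet F := by
  simpa using hF.isOpen_compl.isBorelSet.compl

theorem IsBorelSet.diff {A B : Set E} (hA : IsBorelSet A) (hB : IsBorelSet B) :
    IsBorelSet (A \ B) :=
  @MeasurableSet.diff E (BorelM E) A B hA hB

end Borel

section Measure
variable {L : Type u} {E : Type v} [PartialOrder L] [OrderBot L] [TopologicalSpace E]
  {ν : Set E → L}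

theorem Maxitive.le_of_subset_union (hν : Maxitive ν) {A B C : Set E} {t : L}
    (hA : IsBorelSet A) (hB : IsBorelSet B) (hC : IsBorelSet C) (h : A ⊆ B ∪ C)
    (hBt : ν B ≤ t) (hCt : ν C ≤ t) : ν A ≤ t := by
  have hABC : ν A ≤ ν (⋃₀ {A, B, C}) :=
    (hν.2 {A, B, C} (toFinite _) (by simp [hA, hB, hC])).1 (mem_image_of_mem ν (by simp))
  have heq : ⋃₀ {A, B, C} = ⋃₀ {B, C} := by
    simpa [sUnion_insert] using h
  rw [heq] at hABC
  exact hABC.trans ((hν.2 {B, C} (toFinite _) (by simp [hB, hC])).2 (by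
    rintro _ ⟨D, rfl | rfl, rfl⟩
    exacts [hBt, hCt]))

theorem Maxitive.mono (hν : Maxitive ν) {A B : Set E} (hA : IsBorelSet A) (hB : IsBorelSet B)
    (h : A ⊆ B) : ν A ≤ ν B :=
  hν.le_of_subset_union hA hB hB (by simpa using h) le_rfl le_rfl

theorem OptimalMeasure.exists_le_of_antitone (hν : OptimalMeasure ν) {B : ℕ → Set E}
    (hB : ∀ n, IsBorelSet (B n)) (hanti : Antitone B) {t : L} (ht : WayAbove t (ν (⋂ n, B n))) :
    ∃ n, ν (B n) ≤ t :=
  ht.exists_le_of_antitone (f := fun n => ν (B n))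
    (fun m n hmn => hν.1.1.mono (hB n) (hB m) (hanti hmn))
    (hν.2 B hB fun n => hanti n.le_succ)

/-- `B` lies between a closed and an open set whose difference has arbitrarily small measure. -/
def ClosedOpenApprox (ν : Set E → L) (B : Set E) : Prop :=
  ∀ t : L, WayAbove t ⊥ → ∃ F G : Set E, IsClosed F ∧ IsOpen G ∧ F ⊆ B ∧ B ⊆ G ∧ ν (G \ F) ≤ t

theorem ClosedOpenApprox.compl {B : Set E} (hB : ClosedOpenApprox ν B) :
    ClosedOpenApprox ν Bᶜ := by
  intro t ht
  obtain ⟨F, G, hF, hG, hFB, hBG, h⟩ := hB t ht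
  refine ⟨Gᶜ, Fᶜ, hG.isClosed_compl, hF.isOpen_compl, compl_subset_compl.2 hBG,
    compl_subset_compl.2 hFB, ?_⟩
  rwa [compl_sdiff_compl]

theorem OptimalMeasure.closedOpenApprox_of_isOpen [TopologicalSpace.MetrizableSpace E]
    (hν : OptimalMeasure ν) {G : Set E} (hG : IsOpen G) : ClosedOpenApprox ν G := by
  let _ := TopologicalSpace.metrizableSpaceMetric E
  intro t ht
  obtain ⟨F, hF, hFG, hU, hmono⟩ := hG.exists_iUnion_isClosed
  obtain ⟨n, hn⟩ := hν.exists_le_of_antitone (B := fun n => G \ F n)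
    (fun n => hG.isBorelSet.diff (hF n).isBorelSet)
    (fun m n hmn => sdiff_subset_sdiff_right (hmono hmn))
    (t := t) (by rwa [← sdiff_iUnion, hU, sdiff_self, hν.1.1.1])
  exact ⟨F n, G, hF n, hG, hFG n, subset_rfl, hn⟩

theorem OptimalMeasure.closedOpenApprox_iUnion (hL : ContinuousPoset L) (hν : OptimalMeasure ν)
    {B : ℕ → Set E} (hB : ∀ n, ClosedOpenApprox ν (B n)) : ClosedOpenApprox ν (⋃ n, B n) := by
  intro t ht
  obtain ⟨u, htu, hu⟩ := hL.exists_between ht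
  choose F G hF hG hFB hBG h using fun n => hB n u hu
  have hGU : IsOpen (⋃ n, G n) := isOpen_iUnion hG
  have hFN : ∀ n, IsClosed (accumulate F n) := fun n =>
    (finite_Iic n).isClosed_biUnion fun i _ => hF i
  have hFU : IsBorelSet (⋃ n, F n) :=
    @MeasurableSet.iUnion E ℕ (BorelM E) _ F fun n => (hF n).isBorelSet
  have hD : ∀ n, IsBorelSet (G n \ F n) := fun n =>
    (hG n).isBorelSet.diff (hF n).isBorelSet
  have hDU : IsBorelSet (⋃ n, G n \ F n) :=
    @MeasurableSet.iUnion E ℕ (BorelM E) _ _ hD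
  have hle : ν ((⋃ n, G n) \ ⋃ n, F n) ≤ u := by
    refine (hν.1.1.mono (hGU.isBorelSet.diff hFU) hDU ?_).trans ?_
    · rintro x ⟨hx, hxF⟩
      obtain ⟨n, hn⟩ := mem_iUnion.1 hx
      exact mem_iUnion.2 ⟨n, hn, fun h' => hxF (mem_iUnion.2 ⟨n, h'⟩)⟩
    · refine (hν.1.2 (range fun n => G n \ F n) (countable_range _) ?_).2 ?_
      · rintro _ ⟨n, rfl⟩
        exact hD n
      · rintro _ ⟨_, ⟨n, rfl⟩, rfl⟩
        exact h n
  obtain ⟨n, hn⟩ := hν.exists_le_of_antitone (B := fun n => (⋃ k, G k) \ accumulate F n)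
    (fun n => hGU.isBorelSet.diff (hFN n).isBorelSet)
    (fun m n hmn => sdiff_subset_sdiff_right (monotone_accumulate hmn))
    (t := t) (by rw [← sdiff_iUnion, iUnion_accumulate]; exact htu.mono le_rfl hle)
  refine ⟨accumulate F n, ⋃ k, G k, hFN n, hGU, ?_, iUnion_mono hBG, hn⟩
  exact (accumulate_subset_iUnion n).trans (iUnion_mono hFB)

theorem OptimalMeasure.closedOpenApprox [TopologicalSpace.MetrizableSpace E]
    (hL : ContinuousPoset L) (hν : OptimalMeasure ν) {B : Set E} (hB : IsBorelSet B) :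
    ClosedOpenApprox ν B := by
  refine MeasurableSpace.generateFrom_induction _ (fun B _ => ClosedOpenApprox ν B) ?_ ?_ ?_ ?_ B hB
  · rintro A (hA | hA) -
    · exact hν.closedOpenApprox_of_isOpen hA
    · simpa using (hν.closedOpenApprox_of_isOpen hA.1.isClosed.isOpen_compl).compl
  · exact hν.closedOpenApprox_of_isOpen isOpen_empty
  · exact fun A _ hA => hA.compl
  · exact fun A _ hA => hν.closedOpenApprox_iUnion hL hA

end Measure

/-- on a metrizable space, every optimal measure ν satisfies
`ν(B) = inf {ν G : G open ⊇ B} = sup {ν F : F closed ⊆ B}` for every Borel B. -/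
theorem stmt18 {L : Type u} {E : Type v} [PartialOrder L] [OrderBot L]
    [TopologicalSpace E] [TopologicalSpace.MetrizableSpace E] (hL : DomainPoset L)
    (ν : Set E → L) (hν : OptimalMeasure ν) :
    ∀ B : Set E, IsBorelSet B →
      IsGLB (outerVals ν B) (ν B) ∧
      IsLUB {l : L | ∃ F : Set E, IsClosed F ∧ F ⊆ B ∧ ν F = l} (ν B) := by
  intro B hB
  have hmono {A C : Set E} := hν.1.1.mono (A := A) (B := C)
  have happrox := hν.closedOpenApprox hL.2 hB
  refine ⟨⟨?_, fun b hb => hL.2.le_of_forall_wayAbove fun t ht => ?_⟩,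
    ⟨?_, fun b hb => hL.2.le_of_forall_wayAbove fun t ht => ?_⟩⟩
  · rintro _ ⟨G, hG, hBG, rfl⟩
    exact hmono hB hG.isBorelSet hBG
  · obtain ⟨F, G, hF, hG, hFB, hBG, h⟩ := happrox t (ht.mono le_rfl bot_le)
    refine (hb ⟨G, hG, hBG, rfl⟩).trans ?_
    refine hν.1.1.le_of_subset_union hG.isBorelSet hB (hG.isBorelSet.diff hF.isBorelSet) ?_ ht.le h
    intro x hx
    by_cases hxB : x ∈ B
    exacts [Or.inl hxB, Or.inr ⟨hx, fun hxF => hxB (hFB hxF)⟩]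
  · rintro _ ⟨F, hF, hFB, rfl⟩
    exact hmono hF.isBorelSet hB hFB
  · obtain ⟨F, G, hF, hG, hFB, hBG, h⟩ := happrox t (ht.mono le_rfl bot_le)
    refine hν.1.1.le_of_subset_union hB hF.isBorelSet (hG.isBorelSet.diff hF.isBorelSet) ?_
      ((hb ⟨F, hF, hFB, rfl⟩).trans ht.le) h
    intro x hx
    by_cases hxF : x ∈ F
    exacts [Or.inl hxF, Or.inr ⟨hBG hx, hxF⟩]
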